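/- (Pólya's conjecture for Dirichlet eigenvalues on triangles) For every open triangular region T ⊆ ℝ² (the interior of the convex hull of three non-collinear points) and every integer k ≥ 1, the k-th Dirichlet eigenvalue of the Laplacian on T satisfies λ_k(T) ≥ 4πk/|T|, where |T| is the area of T. -/

import Mathlib

open MeasureTheory Real

/-- The k-th Dirichlet eigenvalue of the Laplacian on `Ω ⊆ ℝⁿ`, defined variationally as
the infimum, over all `k`-dimensional subspaces `E` of the space of smooth compactly
supported functions with support in `Ω`, of the supremum of the Rayleigh quotient
`(∫_Ω ‖∇u‖²) / (∫_Ω u²)` over nonzero `u ∈ E`. -/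
noncomputable def dirichletEig {n : ℕ} (Ω : Set (EuclideanSpace ℝ (Fin n))) (k : ℕ) : ℝ :=
  sInf { r : ℝ | ∃ E : Submodule ℝ (EuclideanSpace ℝ (Fin n) → ℝ),
    Module.finrank ℝ E = k ∧
    (∀ u ∈ E, ContDiff ℝ (⊤ : ℕ∞) u ∧ HasCompactSupport u ∧ tsupport u ⊆ Ω) ∧
    r = sSup { q : ℝ | ∃ u ∈ E, u ≠ (0 : EuclideanSpace ℝ (Fin n) → ℝ) ∧
        q = (∫ x in Ω, ‖gradient u x‖ ^ 2) / (∫ x in Ω, (u x) ^ 2) } }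

section
open UnitAddTorus

variable {d : Type*}

lemma hasCompactSupport_of_tsupport_subset_box {E : Type*} [Zero E] {w : (d → ℝ) → E}
    (hs : tsupport w ⊆ {x | ∀ i, x i ∈ Set.Ioo (0 : ℝ) 1}) : HasCompactSupport w := by
  refine HasCompactSupport.of_support_subset_isCompact
    (isCompact_univ_pi fun _ : d => isCompact_Icc (a := (0 : ℝ)) (b := 1)) ?_
  exact fun x hx i _ => Set.Ioo_subset_Icc_self (hs (subset_tsupport _ hx) i)

variable [Fintype d]

/-- The Fourier coefficient at the frequency `m`. -/
noncomputable def boxFourier (w : (d → ℝ) → ℝ) (m : d → ℤ) : ℂ :=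
  ∫ x, Complex.exp (-(2 * π * Complex.I * ∑ i, (m i : ℂ) * x i)) * w x

lemma mFourier_neg_coe (m : d → ℤ) (x : d → ℝ) :
    mFourier (-m) (fun i => (x i : UnitAddCircle)) =
      Complex.exp (-(2 * π * Complex.I * ∑ i, (m i : ℂ) * x i)) := by
  simp only [mFourier, ContinuousMap.coe_mk, fourier_coe_apply, ← Complex.exp_sum]
  congr 1
  rw [Finset.mul_sum, ← Finset.sum_neg_distrib]
  refine Finset.sum_congr rfl fun i _ => ?_
  simp
  ring

/-- Parseval's identity for functions supported in the open unit box. -/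
theorem hasSum_sq_boxFourier {w : (d → ℝ) → ℝ} (hw : Continuous w)
    (hs : tsupport w ⊆ {x | ∀ i, x i ∈ Set.Ioo (0 : ℝ) 1}) :
    HasSum (fun m => ‖boxFourier w m‖ ^ 2) (∫ x, w x ^ 2) := by
  let _ : MeasureSpace UnitAddCircle := ⟨AddCircle.haarAddCircle⟩
  have : IsProbabilityMeasure (volume : Measure UnitAddCircle) :=
    inferInstanceAs (IsProbabilityMeasure AddCircle.haarAddCircle)
  have hc := hasCompactSupport_of_tsupport_subset_box hs
  obtain ⟨K, hK⟩ := hw.bounded_above_of_compact_support hc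
  set F : UnitAddTorus d → ℂ := fun t => (w (measurableEquivPiIoc (fun _ : d => (0 : ℝ)) t).1 : ℝ)
    with hF
  have hmeas : Measurable F := by
    have := hw.measurable
    have h2 := (measurableEquivPiIoc (fun _ : d => (0 : ℝ))).measurable
    fun_prop
  have hL : MemLp F 2 (volume : Measure (UnitAddTorus d)) :=
    MemLp.of_bound hmeas.aestronglyMeasurable K (Filter.Eventually.of_forall fun t => by
      simpa [hF] using hK _)
  have hval : ∀ x ∈ {x : d → ℝ | ∀ i, x i ∈ Set.Ioc (0 : ℝ) (0 + 1)},
      F (fun i => (x i : UnitAddCircle)) = w x := by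
    intro x hx
    have := (measurableEquivPiIoc (fun _ : d => (0 : ℝ))).apply_symm_apply ⟨x, hx⟩
    simp only [hF]
    exact congrArg (fun y => ((w y.1 : ℝ) : ℂ)) this
  have hbox : MeasurableSet {x : d → ℝ | ∀ i, x i ∈ Set.Ioc (0 : ℝ) (0 + 1)} :=
    MeasurableSet.univ_pi' fun i => measurableSet_Ioc
  have hout : ∀ x ∉ {x : d → ℝ | ∀ i, x i ∈ Set.Ioc (0 : ℝ) (0 + 1)}, w x = 0 := by
    intro x hx
    by_contra h
    refine hx fun i => ?_
    have := hs (subset_tsupport _ h) i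
    simpa using ⟨this.1, this.2.le⟩
  have key := hasSum_sq_mFourierCoeff (hL.toLp F)
  have h1 : ∫ t, ‖(hL.toLp F) t‖ ^ 2 = ∫ x, w x ^ 2 := by
    rw [integral_congr_ae (g := fun t => ‖F t‖ ^ 2)
      (hL.coeFn_toLp.mono fun t ht => by simp only [ht]), integral_preimage _ (fun _ => 0),
      setIntegral_congr_fun (g := fun x => w x ^ 2) hbox (fun x hx => by
        simp only [hval x hx]; simp)]
    exact setIntegral_eq_integral_of_forall_compl_eq_zero fun x hx => by simp [hout x hx]
  have h2 : ∀ m, mFourierCoeff (hL.toLp F) m = boxFourier w m := by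
    intro m
    have : mFourierCoeff (hL.toLp F) m = mFourierCoeff F m :=
      integral_congr_ae (hL.coeFn_toLp.mono fun t ht => by simp only [ht])
    rw [this, mFourierCoeff_eq_integral _ _ (fun _ => 0),
      setIntegral_congr_fun (g := fun x =>
        Complex.exp (-(2 * π * Complex.I * ∑ i, (m i : ℂ) * x i)) * w x) hbox (fun x hx => by
          simp only [hval x hx, mFourier_neg_coe, smul_eq_mul])]
    exact setIntegral_eq_integral_of_forall_compl_eq_zero fun x hx => by simp [hout x hx]
  simp only [h2] at key
  rwa [h1] at key

theorem boxFourier_fderiv {w : (d → ℝ) → ℝ} (hw : ContDiff ℝ 1 w) (hc : HasCompactSupport w)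
    (α : d → ℝ) (m : d → ℤ) :
    boxFourier (fun x => fderiv ℝ w x α) m =
      2 * π * Complex.I * ((∑ i, α i * m i : ℝ) : ℂ) * boxFourier w m := by
  set e : (d → ℝ) → ℂ := fun x => Complex.exp (-(2 * π * Complex.I * ∑ i, (m i : ℂ) * x i))
  have he : ContDiff ℝ 1 e := by
    have : ∀ i, ContDiff ℝ 1 fun x : d → ℝ => (x i : ℂ) := fun i =>
      Complex.ofRealCLM.contDiff.comp (contDiff_apply ℝ ℝ i)
    fun_prop
  have hwC : ContDiff ℝ 1 fun x => (w x : ℂ) := Complex.ofRealCLM.contDiff.comp hw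
  have hcC : HasCompactSupport fun x => (w x : ℂ) := hc.comp_left (g := Complex.ofReal) (by simp)
  have hd : ∀ x, fderiv ℝ (fun x => (w x : ℂ)) x α = (fderiv ℝ w x α : ℝ) := by
    intro x
    have h := (Complex.ofRealCLM.hasFDerivAt (x := w x)).comp x
      (hw.differentiable one_ne_zero x).hasFDerivAt
    have h' : HasFDerivAt (fun x => (w x : ℂ)) _ x := h
    rw [h'.fderiv]; simp
  have hde : ∀ x, fderiv ℝ e x α = -(2 * π * Complex.I * ((∑ i, α i * m i : ℝ) : ℂ)) * e x := by
    intro x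
    set ℓ : (d → ℝ) →L[ℝ] ℂ := ∑ i, (m i : ℂ) • Complex.ofRealCLM.comp
      (ContinuousLinearMap.proj (R := ℝ) (φ := fun _ : d => ℝ) i) with hℓ
    have h1 : HasFDerivAt (fun x : d → ℝ => ∑ i, (m i : ℂ) * x i) ℓ x := by
      refine HasFDerivAt.fun_sum fun i _ => ?_
      exact ((Complex.ofRealCLM.comp
        (ContinuousLinearMap.proj (R := ℝ) (φ := fun _ : d => ℝ) i)).hasFDerivAt).const_smul
          (m i : ℂ)
    have h2 : HasFDerivAt e (e x • -((2 * π * Complex.I) • ℓ)) x :=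
      ((h1.const_mul (2 * π * Complex.I)).fun_neg).cexp
    rw [h2.fderiv, hℓ]
    simp only [neg_apply, smul_apply, sum_apply, ContinuousLinearMap.comp_apply,
      ContinuousLinearMap.proj_apply, Complex.ofRealCLM_apply, smul_eq_mul, Complex.ofReal_sum,
      Complex.ofReal_mul, Complex.ofReal_intCast, mul_comm (m _ : ℂ) (α _ : ℂ)]
    ring
  have hcE : Continuous fun x => fderiv ℝ e x α :=
    (he.continuous_fderiv one_ne_zero).clm_apply continuous_const
  have hcW : Continuous fun x => fderiv ℝ (fun x => (w x : ℂ)) x α :=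
    (hwC.continuous_fderiv one_ne_zero).clm_apply continuous_const
  have := integral_mul_fderiv_eq_neg_fderiv_mul_of_integrable (μ := volume) (𝕜 := ℂ) (f := e)
    (g := fun x => (w x : ℂ)) (v := α)
    ((hcE.mul hwC.continuous).integrable_of_hasCompactSupport hcC.mul_left)
    ((he.continuous.mul hcW).integrable_of_hasCompactSupport
      (HasCompactSupport.mul_left (hcC.fderiv_apply ℝ α)))
    ((he.continuous.mul hwC.continuous).integrable_of_hasCompactSupport hcC.mul_left)
    (fun x _ => he.differentiable one_ne_zero x) (fun x _ => hwC.differentiable one_ne_zero x)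
  simp only [hd, hde] at this
  rw [boxFourier, this, boxFourier, ← integral_const_mul, ← integral_neg]
  congr 1; ext x; ring

/-- A space of functions supported in the open unit box on which the energy is less than `M`
times the squared `L²` norm has dimension at most the number of frequencies of energy less than
`M`. -/
theorem finrank_le_card_of_energy_lt {W ι : Type*} [AddCommGroup W] [Module ℝ W]
    [FiniteDimensional ℝ W] [Fintype ι] (Θ : W →ₗ[ℝ] (d → ℝ) → ℝ)
    (hΘ : ∀ U, ContDiff ℝ 1 (Θ U))
    (hs : ∀ U, tsupport (Θ U) ⊆ {x | ∀ i, x i ∈ Set.Ioo (0 : ℝ) 1}) (α : ι → d → ℝ) (M : ℝ)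
    (hlt : ∀ U, U ≠ 0 → ∑ i, ∫ x, fderiv ℝ (Θ U) x (α i) ^ 2 < M * ∫ x, Θ U x ^ 2)
    (S : Finset (d → ℤ))
    (hS : ∀ m, m ∈ S ↔ (2 * π) ^ 2 * ∑ i, (∑ j, α i j * m j) ^ 2 < M) :
    Module.finrank ℝ W ≤ S.card := by
  have hc := fun U => hasCompactSupport_of_tsupport_subset_box (hs U)
  have hexp : ∀ U (m : d → ℤ), Integrable fun x =>
      Complex.exp (-(2 * π * Complex.I * ∑ i, (m i : ℂ) * x i)) * Θ U x := by
    intro U m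
    refine Continuous.integrable_of_hasCompactSupport ?_ ?_
    · have := (hΘ U).continuous
      fun_prop
    · exact HasCompactSupport.mul_left ((hc U).comp_left (g := Complex.ofReal) (by simp))
  have hadd : ∀ U V m, boxFourier (Θ (U + V)) m = boxFourier (Θ U) m + boxFourier (Θ V) m := by
    intro U V m
    rw [boxFourier, boxFourier, boxFourier, ← integral_add (hexp U m) (hexp V m)]
    congr 1; ext x; simp; ring
  have hsmul : ∀ (c : ℝ) U m, boxFourier (Θ (c • U)) m = c * boxFourier (Θ U) m := by
    intro c U m
    rw [boxFourier, boxFourier, ← integral_const_mul]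
    congr 1; ext x; simp; ring
  have hconj : ∀ (w : (d → ℝ) → ℝ) m, boxFourier w (-m) = starRingEnd ℂ (boxFourier w m) := by
    intro w m
    rw [boxFourier, boxFourier, ← integral_conj]
    congr 1; ext x
    simp [← Complex.exp_conj, Complex.conj_ofNat]
  by_contra! hcard
  let H : W →ₗ[ℝ] (S → ℝ) :=
    { toFun := fun U m => (boxFourier (Θ U) m).re + (boxFourier (Θ U) m).im
      map_add' := fun U V => by
        ext m
        simp only [hadd, Complex.add_re, Complex.add_im, Pi.add_apply]
        ring
      map_smul' := fun c U => by
        ext m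
        change (boxFourier (Θ (c • U)) m).re + (boxFourier (Θ (c • U)) m).im = _
        simp only [hsmul, Complex.re_ofReal_mul, Complex.im_ofReal_mul, Pi.smul_apply,
          RingHom.id_apply, smul_eq_mul]
        ring }
  obtain ⟨U, hU, hU0⟩ := (Submodule.ne_bot_iff _).1
    (LinearMap.ker_ne_bot_of_finrank_lt (f := H) (by simpa using hcard))
  have hzero : ∀ m ∈ S, boxFourier (Θ U) m = 0 := by
    intro m hm
    have hm' : -m ∈ S := by
      rw [hS] at hm ⊢
      simpa using hm
    have h1 : (boxFourier (Θ U) m).re + (boxFourier (Θ U) m).im = 0 :=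
      congrFun (LinearMap.mem_ker.1 hU) ⟨m, hm⟩
    have h2 : (boxFourier (Θ U) (-m)).re + (boxFourier (Θ U) (-m)).im = 0 :=
      congrFun (LinearMap.mem_ker.1 hU) ⟨-m, hm'⟩
    rw [hconj, Complex.conj_re, Complex.conj_im] at h2
    exact Complex.ext (by simp; linarith) (by simp; linarith)
  have hsum := (hasSum_sq_boxFourier (hΘ U).continuous (hs U)).mul_left M
  have hsumd : ∀ i, HasSum (fun m => ((2 * π) ^ 2 * (∑ j, α i j * m j) ^ 2) *
      ‖boxFourier (Θ U) m‖ ^ 2) (∫ x, fderiv ℝ (Θ U) x (α i) ^ 2) := by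
    intro i
    refine (hasSum_sq_boxFourier (((hΘ U).continuous_fderiv one_ne_zero).clm_apply
      continuous_const) ((tsupport_fderiv_apply_subset ℝ (α i)).trans (hs U))).congr_fun ?_
    intro m
    rw [boxFourier_fderiv (hΘ U) (hc U), norm_mul, mul_pow]
    simp only [norm_mul, Complex.norm_ofNat, Complex.norm_I, Complex.norm_real, mul_pow,
      Real.norm_eq_abs, sq_abs, mul_one]
  refine absurd (hlt U hU0) (not_lt.2 (hasSum_le (fun m => ?_) hsum
    (hasSum_sum fun i _ => hsumd i)))
  by_cases hm : m ∈ S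
  · simp [hzero m hm]
  · rw [← Finset.sum_mul, ← Finset.mul_sum]
    gcongr
    rw [hS] at hm
    exact not_lt.1 hm

end

section
open scoped Pointwise

/-- The open ellipse of frequencies of energy less than `M`. -/
def freqEllipse (P : Matrix (Fin 2) (Fin 2) ℝ) (M : ℝ) : Set (Fin 2 → ℝ) :=
  {x | (2 * π) ^ 2 * ∑ i, (∑ j, P i j * x j) ^ 2 < M}

/-- The linear equivalence of the plane given by an invertible matrix. -/
noncomputable def matrixEquiv (P : Matrix (Fin 2) (Fin 2) ℝ) (hP : P.det ≠ 0) :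
    (Fin 2 → ℝ) ≃L[ℝ] EuclideanSpace ℝ (Fin 2) :=
  (LinearMap.equivOfDetNeZero (Matrix.toLin' P)
    (by rwa [LinearMap.det_toLin'])).toContinuousLinearEquiv.trans
    (EuclideanSpace.equiv (Fin 2) ℝ).symm

lemma matrixEquiv_apply (P : Matrix (Fin 2) (Fin 2) ℝ) (hP : P.det ≠ 0) (x : Fin 2 → ℝ) :
    matrixEquiv P hP x = WithLp.toLp 2 (P.mulVec x) := rfl

lemma volume_preimage_matrixEquiv (P : Matrix (Fin 2) (Fin 2) ℝ) (hP : P.det ≠ 0)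
    (s : Set (EuclideanSpace ℝ (Fin 2))) (hs : MeasurableSet s) :
    volume (matrixEquiv P hP ⁻¹' s) = ENNReal.ofReal |P.det|⁻¹ * volume s := by
  have h : matrixEquiv P hP ⁻¹' s = Matrix.toLin' P ⁻¹' (WithLp.toLp 2 ⁻¹' s) := rfl
  rw [h, Measure.addHaar_preimage_linearMap _ (by rwa [LinearMap.det_toLin']),
    LinearMap.det_toLin', abs_inv,
    (PiLp.volume_preserving_toLp (Fin 2)).measure_preimage hs.nullMeasurableSet]

lemma map_matrixEquiv_volume (P : Matrix (Fin 2) (Fin 2) ℝ) (hP : P.det ≠ 0) :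
    Measure.map (matrixEquiv P hP) volume = ENNReal.ofReal |P.det|⁻¹ • volume := by
  ext s hs
  rw [Measure.map_apply (matrixEquiv P hP).continuous.measurable hs,
    volume_preimage_matrixEquiv P hP s hs, Measure.smul_apply, smul_eq_mul]

lemma freqEllipse_eq (P : Matrix (Fin 2) (Fin 2) ℝ) (hP : P.det ≠ 0) (M : ℝ) :
    freqEllipse P M = matrixEquiv P hP ⁻¹' Metric.ball 0 (√M / (2 * π)) := by
  ext x
  simp only [freqEllipse, Set.mem_ofPred_eq, Set.mem_preimage, mem_ball_zero_iff, matrixEquiv_apply,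
    EuclideanSpace.norm_eq, norm_eq_abs, sq_abs, Matrix.mulVec, dotProduct]
  rw [lt_div_iff₀ (by positivity), Real.lt_sqrt (by positivity), mul_pow √_,
    Real.sq_sqrt (by positivity), mul_comm]

lemma volume_freqEllipse (P : Matrix (Fin 2) (Fin 2) ℝ) (hP : P.det ≠ 0) {M : ℝ} (hM : 0 < M) :
    volume.real (freqEllipse P M) = M / (4 * π * |P.det|) := by
  rw [Measure.real, freqEllipse_eq P hP M, volume_preimage_matrixEquiv _ _ _ measurableSet_ball,
    EuclideanSpace.volume_ball_fin_two, ENNReal.toReal_mul, ENNReal.toReal_mul, ENNReal.toReal_pow,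
    ENNReal.toReal_ofReal (by positivity), ENNReal.toReal_ofReal (by positivity),
    ENNReal.toReal_ofReal (by positivity), div_pow, Real.sq_sqrt hM.le]
  have := abs_pos.2 hP
  field_simp
  norm_num

theorem le_of_sq_mul_le_card_freqEllipse (P : Matrix (Fin 2) (Fin 2) ℝ) (hP : P.det ≠ 0) {M : ℝ}
    (hM : 0 < M) (N : ℕ)
    (hN : ∀ n : ℕ, 0 < n → ∀ S : Finset (Fin 2 → ℤ),
      (∀ m, m ∈ S ↔ (2 * π) ^ 2 * ∑ i, (∑ j, P i j * m j) ^ 2 < n ^ 2 * M) →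
        n ^ 2 * N ≤ S.card) :
    (N : ℝ) ≤ M / (4 * π * |P.det|) := by
  have heq := freqEllipse_eq P hP M
  have hconv : Convex ℝ (freqEllipse P M) := by
    rw [heq]
    exact (convex_ball _ _).linear_preimage (matrixEquiv P hP).toLinearMap
  have hbdd : Bornology.IsBounded (freqEllipse P M) := by
    rw [heq]
    exact (matrixEquiv P hP).antilipschitz.isBounded_preimage Metric.isBounded_ball
  have hmeas : MeasurableSet (freqEllipse P M) := by
    rw [heq]
    exact (matrixEquiv P hP).continuous.measurable measurableSet_ball
  have hlim := tendsto_card_div_pow_atTop_volume (freqEllipse P M) hbdd hmeas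
    (hconv.addHaar_frontier volume)
  rw [volume_freqEllipse P hP hM] at hlim
  refine ge_of_tendsto hlim ?_
  filter_upwards [Filter.eventually_gt_atTop 0] with n hn
  have hn' : (0 : ℝ) < n := Nat.cast_pos.2 hn
  set L : Set (Fin 2 → ℝ) := ↑(Submodule.span ℤ (Set.range (Pi.basisFun ℝ (Fin 2)))) with hL
  have hmemL : ∀ y, y ∈ L ↔ ∃ m : Fin 2 → ℤ, (fun i => (m i : ℝ)) = y := by
    intro y
    rw [hL, SetLike.mem_coe, Module.Basis.mem_span_iff_repr_mem]
    simp only [Pi.basisFun_repr, Set.mem_range, algebraMap_int_eq, eq_intCast]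
    exact ⟨fun h => ⟨fun i => (h i).choose, funext fun i => (h i).choose_spec⟩,
      fun ⟨m, hm⟩ i => ⟨m i, congrFun hm i⟩⟩
  set g : (Fin 2 → ℤ) → (Fin 2 → ℝ) := fun m => (n : ℝ)⁻¹ • fun i => (m i : ℝ) with hg
  have hginj : Function.Injective g := by
    intro m m' h
    have := smul_right_injective (Fin 2 → ℝ) (inv_ne_zero hn'.ne') h
    exact funext fun i => Int.cast_injective (congrFun this i)
  have himg : freqEllipse P M ∩ (n : ℝ)⁻¹ • L = g '' {m | (2 * π) ^ 2 *
      ∑ i, (∑ j, P i j * m j) ^ 2 < n ^ 2 * M} := by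
    have hmem : ∀ m, g m ∈ freqEllipse P M ↔
        (2 * π) ^ 2 * ∑ i, (∑ j, P i j * m j) ^ 2 < n ^ 2 * M := by
      intro m
      simp only [hg, freqEllipse, Set.mem_ofPred_eq, Pi.smul_apply, smul_eq_mul,
        mul_left_comm _ (n : ℝ)⁻¹, ← Finset.mul_sum, mul_pow, inv_pow]
      rw [mul_left_comm, inv_mul_lt_iff₀ (by positivity)]
    ext y
    constructor
    · rintro ⟨hy, z, hz, rfl⟩
      obtain ⟨m, rfl⟩ := (hmemL z).1 hz
      exact ⟨m, (hmem m).1 hy, rfl⟩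
    · rintro ⟨m, hm, rfl⟩
      exact ⟨(hmem m).2 hm, _, (hmemL _).2 ⟨m, rfl⟩, rfl⟩
  have hfin : (freqEllipse P M ∩ (n : ℝ)⁻¹ • L).Finite := by
    have hb : Bornology.IsBounded ((n : ℝ) • freqEllipse P M) := hbdd.smul₀ _
    refine ((ZSpan.setFinite_inter (Pi.basisFun ℝ (Fin 2)) hb).image
      (fun x => (n : ℝ)⁻¹ • x)).subset ?_
    rintro y ⟨hy, z, hz, rfl⟩
    refine ⟨z, ⟨⟨_, hy, ?_⟩, hz⟩, rfl⟩
    simp [smul_smul, hn'.ne']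
  rw [himg] at hfin ⊢
  have hfin' := hfin.of_finite_image hginj.injOn
  have hcard := hN n hn hfin'.toFinset (by simp)
  rw [Nat.card_image_of_injective hginj, Nat.card_coe_set_eq, Set.ncard_eq_toFinset_card _ hfin',
    Fintype.card_fin, le_div_iff₀ (by positivity), mul_comm]
  exact_mod_cast hcard

end

section

/-- The standard open triangle. -/
def stdTriangle : Set (Fin 2 → ℝ) := {x | 0 < x 0 ∧ 0 < x 1 ∧ x 0 + x 1 < 1}

/-- The affine maps taking the small triangles of the subdivision of the unit square with mesh
`1 / n` to the standard triangle. -/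
noncomputable def tileMap (n : ℕ) (j : Fin n × Fin n × Bool) (x : Fin 2 → ℝ) : Fin 2 → ℝ :=
  (if j.2.2 then -(n : ℝ) else n) • x +
    if j.2.2 then ![(j.1 : ℝ) + 1, (j.2.1 : ℝ) + 1] else ![-(j.1 : ℝ), -(j.2.1 : ℝ)]

lemma mem_box_of_tileMap_mem {n : ℕ} {j : Fin n × Fin n × Bool} {x : Fin 2 → ℝ}
    (h : tileMap n j x ∈ stdTriangle) (i : Fin 2) : x i ∈ Set.Ioo (0 : ℝ) 1 := by
  obtain ⟨a, b, s⟩ := j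
  have hn : (0 : ℝ) < n := Nat.cast_pos.2 a.pos
  have ha : (a : ℝ) + 1 ≤ n := by exact_mod_cast a.2
  have hb : (b : ℝ) + 1 ≤ n := by exact_mod_cast b.2
  have ha0 : (0 : ℝ) ≤ a := Nat.cast_nonneg _
  have hb0 : (0 : ℝ) ≤ b := Nat.cast_nonneg _
  have key : ∀ y : ℝ, 0 < n * y → n * y < n → y ∈ Set.Ioo (0 : ℝ) 1 := fun y h1 h2 =>
    ⟨pos_of_mul_pos_right h1 hn.le, by nlinarith⟩
  cases s <;> simp [tileMap, stdTriangle, Matrix.vecHead, Matrix.vecTail] at h <;>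
    fin_cases i <;> apply key <;> simp <;> linarith

lemma eq_of_tileMap_mem {n : ℕ} {j k : Fin n × Fin n × Bool} {x : Fin 2 → ℝ}
    (hj : tileMap n j x ∈ stdTriangle) (hk : tileMap n k x ∈ stdTriangle) : j = k := by
  obtain ⟨a, b, s⟩ := j
  obtain ⟨a', b', s'⟩ := k
  have key : ∀ (p q : Fin n) (y : ℝ), (p : ℝ) < y → y < p + 1 → (q : ℝ) < y → y < q + 1 →
      p = q := by
    intro p q y h1 h2 h3 h4
    have h5 : (p : ℝ) < q + 1 := h1.trans h4
    have h6 : (q : ℝ) < p + 1 := h3.trans h2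
    norm_cast at h5 h6
    exact Fin.ext (by omega)
  have haa : a = a' := by
    refine key a a' (n * x 0) ?_ ?_ ?_ ?_ <;> cases s <;> cases s' <;>
      simp [tileMap, stdTriangle, Matrix.vecHead, Matrix.vecTail] at hj hk <;> linarith
  have hbb : b = b' := by
    refine key b b' (n * x 1) ?_ ?_ ?_ ?_ <;> cases s <;> cases s' <;>
      simp [tileMap, stdTriangle, Matrix.vecHead, Matrix.vecTail] at hj hk <;> linarith
  subst haa hbb
  cases s <;> cases s' <;>
    simp [tileMap, stdTriangle, Matrix.vecHead, Matrix.vecTail] at hj hk ⊢ <;> linarith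

lemma sq_sum_eq_of_mul_eq_zero {J : Type*} [Fintype J] (a : J → ℝ)
    (h : ∀ j k, j ≠ k → a j * a k = 0) : (∑ j, a j) ^ 2 = ∑ j, a j ^ 2 := by
  rw [sq, Finset.sum_mul_sum]
  refine Finset.sum_congr rfl fun j _ => ?_
  rw [Finset.sum_eq_single j (fun k _ hk => h j k hk.symm) (by simp), sq]

lemma integral_comp_tileMap (n : ℕ) (j : Fin n × Fin n × Bool) (f : (Fin 2 → ℝ) → ℝ) :
    ∫ x, f (tileMap n j x) = ((n : ℝ) ^ 2)⁻¹ * ∫ x, f x := by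
  simp only [tileMap]
  rw [Measure.integral_comp_smul volume (fun y => f (y + _)),
    integral_add_right_eq_self (μ := volume) f]
  split_ifs <;> simp

lemma continuous_tileMap (n : ℕ) (j : Fin n × Fin n × Bool) : Continuous (tileMap n j) := by
  unfold tileMap; fun_prop

lemma contDiff_tileMap (n : ℕ) (j : Fin n × Fin n × Bool) : ContDiff ℝ 1 (tileMap n j) := by
  unfold tileMap; fun_prop

lemma fderiv_comp_tileMap_sq {n : ℕ} (j : Fin n × Fin n × Bool) {f : (Fin 2 → ℝ) → ℝ}
    (hf : ContDiff ℝ 1 f) (x α : Fin 2 → ℝ) :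
    fderiv ℝ (fun x => f (tileMap n j x)) x α ^ 2 =
      n ^ 2 * fderiv ℝ f (tileMap n j x) α ^ 2 := by
  have h1 : HasFDerivAt (tileMap n j) ((if j.2.2 then -(n : ℝ) else n) •
      ContinuousLinearMap.id ℝ (Fin 2 → ℝ)) x :=
    HasFDerivAt.add_const _ (HasFDerivAt.fun_const_smul (hasFDerivAt_id x) _)
  have h2 : HasFDerivAt (fun x => f (tileMap n j x)) _ x :=
    ((hf.differentiable one_ne_zero (tileMap n j x)).hasFDerivAt).comp x h1
  rw [h2.fderiv]
  simp only [ContinuousLinearMap.comp_apply, smul_apply, map_smul, smul_eq_mul, mul_pow,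
    ContinuousLinearMap.id_apply]
  split_ifs <;> simp

lemma integrable_sq_of_hasCompactSupport {X : Type*} [TopologicalSpace X] [MeasurableSpace X]
    [OpensMeasurableSpace X] {μ : Measure X} [IsFiniteMeasureOnCompacts μ] {f : X → ℝ}
    (hf : Continuous f) (h : HasCompactSupport f) : Integrable (fun x => f x ^ 2) μ := by
  simp only [sq]
  exact (hf.mul hf).integrable_of_hasCompactSupport h.mul_right

/-- The bound obtained by putting a copy of a test space of the standard triangle on each of the
`2 * n ^ 2` tiles of the unit square. -/
theorem mul_finrank_le_card_of_energy_lt {E ι : Type*} [AddCommGroup E] [Module ℝ E]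
    [FiniteDimensional ℝ E] [Fintype ι] (V : E →ₗ[ℝ] (Fin 2 → ℝ) → ℝ)
    (hV : ∀ u, ContDiff ℝ 1 (V u))
    (hs : ∀ u, tsupport (V u) ⊆ stdTriangle) (α : ι → Fin 2 → ℝ) (M : ℝ)
    (hlt : ∀ u, u ≠ 0 → ∑ i, ∫ x, fderiv ℝ (V u) x (α i) ^ 2 < M * ∫ x, V u x ^ 2)
    {n : ℕ} (hn : 0 < n) (S : Finset (Fin 2 → ℤ))
    (hS : ∀ m, m ∈ S ↔ (2 * π) ^ 2 * ∑ i, (∑ j, α i j * m j) ^ 2 < n ^ 2 * M) :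
    n ^ 2 * (2 * Module.finrank ℝ E) ≤ S.card := by
  have hn' : (0 : ℝ) < n := Nat.cast_pos.2 hn
  obtain ⟨Θ, hΘ⟩ : ∃ Θ : (Fin n × Fin n × Bool → E) →ₗ[ℝ] (Fin 2 → ℝ) → ℝ,
      ∀ U, Θ U = fun x => ∑ j, V (U j) (tileMap n j x) :=
    ⟨{ toFun := fun U x => ∑ j, V (U j) (tileMap n j x)
       map_add' := fun U U' => by ext x; simp [Finset.sum_add_distrib]
       map_smul' := fun c U => by ext x; simp [Finset.mul_sum] }, fun U => rfl⟩
  have hfin : Module.finrank ℝ (Fin n × Fin n × Bool → E) = n ^ 2 * (2 * Module.finrank ℝ E) := by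
    simp [Module.finrank_pi_fintype]
    ring
  rw [← hfin]
  have hcd : ∀ (U : Fin n × Fin n × Bool → E) j, ContDiff ℝ 1 fun x => V (U j) (tileMap n j x) :=
    fun U j =>
    (hV (U j)).comp (contDiff_tileMap n j)
  have hcs : ∀ (U : Fin n × Fin n × Bool → E) j,
      HasCompactSupport fun x => V (U j) (tileMap n j x) := fun U j =>
    hasCompactSupport_of_tsupport_subset_box fun x hx => mem_box_of_tileMap_mem
      (hs _ (tsupport_comp_subset_preimage (V (U j)) (continuous_tileMap n j) hx))
  have hsq : ∀ U, ∫ x, Θ U x ^ 2 = ((n : ℝ) ^ 2)⁻¹ * ∑ j, ∫ x, V (U j) x ^ 2 := by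
    intro U
    have h1 : ∀ x, Θ U x ^ 2 = ∑ j, V (U j) (tileMap n j x) ^ 2 := by
      intro x
      rw [hΘ]
      refine sq_sum_eq_of_mul_eq_zero _ fun j k hjk => ?_
      by_contra h
      exact hjk (eq_of_tileMap_mem (hs _ (subset_tsupport _ (left_ne_zero_of_mul h)))
        (hs _ (subset_tsupport _ (right_ne_zero_of_mul h))))
    simp only [h1]
    rw [integral_finsetSum, Finset.mul_sum]
    · exact Finset.sum_congr rfl fun j _ => integral_comp_tileMap n j fun y => V (U j) y ^ 2
    · exact fun j _ => integrable_sq_of_hasCompactSupport (hcd U j).continuous (hcs U j)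
  have hdsq : ∀ U (β : Fin 2 → ℝ), ∫ x, fderiv ℝ (Θ U) x β ^ 2 =
      ∑ j, ∫ x, fderiv ℝ (V (U j)) x β ^ 2 := by
    intro U β
    have h1 : ∀ x, fderiv ℝ (Θ U) x β ^ 2 =
        ∑ j, n ^ 2 * fderiv ℝ (V (U j)) (tileMap n j x) β ^ 2 := by
      intro x
      rw [hΘ, fderiv_fun_sum fun j _ => (hcd U j).differentiable one_ne_zero x]
      simp only [← fderiv_comp_tileMap_sq _ (hV _), sum_apply]
      refine sq_sum_eq_of_mul_eq_zero _ fun j k hjk => ?_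
      by_contra h
      have hmem : ∀ l, fderiv ℝ (fun x => V (U l) (tileMap n l x)) x β ≠ 0 →
          tileMap n l x ∈ stdTriangle := by
        intro l hl
        refine hs (U l) (tsupport_fderiv_apply_subset ℝ β (subset_tsupport _ ?_))
        have := pow_ne_zero 2 hl
        rw [fderiv_comp_tileMap_sq _ (hV _)] at this
        exact (pow_ne_zero_iff two_ne_zero).1 (right_ne_zero_of_mul this)
      exact hjk (eq_of_tileMap_mem (hmem j (left_ne_zero_of_mul h))
        (hmem k (right_ne_zero_of_mul h)))
    simp only [h1]
    rw [integral_finsetSum]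
    · refine Finset.sum_congr rfl fun j _ => ?_
      rw [integral_const_mul, integral_comp_tileMap n j fun y => fderiv ℝ (V (U j)) y β ^ 2]
      field_simp
    · intro j _
      simp only [← fderiv_comp_tileMap_sq _ (hV _)]
      exact integrable_sq_of_hasCompactSupport (((hcd U j).continuous_fderiv
        one_ne_zero).clm_apply continuous_const) ((hcs U j).fderiv_apply ℝ β)
  refine finrank_le_card_of_energy_lt Θ
    (fun U => by rw [hΘ]; exact ContDiff.sum fun j _ => hcd U j) (fun U => ?_) α (n ^ 2 * M)
    (fun U hU => ?_) S hS
  · have h1 : IsClosed (⋃ j, tileMap n j ⁻¹' tsupport (V (U j))) :=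
      isClosed_iUnion_of_finite fun j => (isClosed_tsupport _).preimage (continuous_tileMap n j)
    refine (closure_minimal (fun x hx => ?_) h1).trans ?_
    · rw [hΘ] at hx
      obtain ⟨j, -, hj⟩ := Finset.exists_ne_zero_of_sum_ne_zero (Function.mem_support.1 hx)
      exact Set.mem_iUnion.2 ⟨j, subset_tsupport _ hj⟩
    · intro x hx
      obtain ⟨j, hj⟩ := Set.mem_iUnion.1 hx
      exact mem_box_of_tileMap_mem (hs _ hj)
  · simp only [hdsq, hsq]
    rw [Finset.sum_comm, mul_right_comm, mul_inv_cancel_left₀ (by positivity), mul_comm,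
      Finset.mul_sum]
    obtain ⟨j₀, hj₀⟩ := Function.ne_iff.1 hU
    refine Finset.sum_lt_sum (fun j _ => ?_) ⟨j₀, Finset.mem_univ _, hlt _ hj₀⟩
    by_cases hj : U j = 0
    · simp [hj]
    · exact (hlt _ hj).le

end

lemma det_edges_ne_zero {A B C : EuclideanSpace ℝ (Fin 2)}
    (h : ¬ Collinear ℝ ({A, B, C} : Set (EuclideanSpace ℝ (Fin 2)))) :
    (!![B 0 - A 0, C 0 - A 0; B 1 - A 1, C 1 - A 1] : Matrix (Fin 2) (Fin 2) ℝ).det ≠ 0 := by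
  contrapose! h
  rw [Matrix.det_fin_two_of] at h
  rw [collinear_iff_of_mem (p₀ := A) (by simp)]
  by_cases h0 : B 0 - A 0 = 0
  · by_cases h1 : B 1 - A 1 = 0
    · refine ⟨C - A, ?_⟩
      simp only [Set.mem_insert_iff, Set.mem_singleton_iff, forall_eq_or_imp, forall_eq]
      refine ⟨⟨0, by simp⟩, ⟨0, ?_⟩, ⟨1, by simp⟩⟩
      ext i
      fin_cases i <;> simp <;> linarith
    · refine ⟨B - A, ?_⟩
      simp only [Set.mem_insert_iff, Set.mem_singleton_iff, forall_eq_or_imp, forall_eq]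
      refine ⟨⟨0, by simp⟩, ⟨1, by simp⟩, ⟨(C 1 - A 1) / (B 1 - A 1), ?_⟩⟩
      ext i
      fin_cases i <;> simp <;> field_simp <;> linarith
  · refine ⟨B - A, ?_⟩
    simp only [Set.mem_insert_iff, Set.mem_singleton_iff, forall_eq_or_imp, forall_eq]
    refine ⟨⟨0, by simp⟩, ⟨1, by simp⟩, ⟨(C 0 - A 0) / (B 0 - A 0), ?_⟩⟩
    ext i
    fin_cases i <;> simp <;> field_simp <;> linarith

lemma preimage_interior_convexHull {A B C : EuclideanSpace ℝ (Fin 2)}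
    (h : ¬ Collinear ℝ ({A, B, C} : Set (EuclideanSpace ℝ (Fin 2)))) :
    (fun x => matrixEquiv _ (det_edges_ne_zero h) x + A) ⁻¹'
      interior (convexHull ℝ {A, B, C}) = stdTriangle := by
  have hi : AffineIndependent ℝ ![A, B, C] := affineIndependent_iff_not_collinear_set.2 h
  let b : AffineBasis (Fin 3) ℝ (EuclideanSpace ℝ (Fin 2)) :=
    ⟨![A, B, C], hi, hi.affineSpan_eq_top_iff_card_eq_finrank_add_one.2 (by simp)⟩
  have hr : Set.range b = {A, B, C} := by
    change Set.range ![A, B, C] = _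
    rw [Matrix.range_cons, Matrix.range_cons, Matrix.range_cons, Matrix.range_empty,
      Set.union_empty]
    rfl
  rw [← hr, b.interior_convexHull]
  ext x
  have hx : matrixEquiv _ (det_edges_ne_zero h) x + A =
      Finset.univ.affineCombination ℝ b ![1 - x 0 - x 1, x 0, x 1] := by
    rw [Finset.affineCombination_eq_linear_combination _ _ _ (by simp [Fin.sum_univ_three]; ring),
      Fin.sum_univ_three]
    change _ = (1 - x 0 - x 1) • A + x 0 • B + x 1 • C
    rw [matrixEquiv_apply]
    ext i
    fin_cases i <;> simp [Matrix.vecHead, Matrix.vecTail] <;> ring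
  simp only [Set.mem_preimage, Set.mem_ofPred_eq, hx, stdTriangle, Fin.forall_fin_succ]
  rw [b.coord_apply_combination_of_mem (Finset.mem_univ _) (by simp [Fin.sum_univ_three]; ring),
    b.coord_apply_combination_of_mem (Finset.mem_univ _) (by simp [Fin.sum_univ_three]; ring),
    b.coord_apply_combination_of_mem (Finset.mem_univ _) (by simp [Fin.sum_univ_three]; ring)]
  simp
  constructor <;> rintro ⟨h1, h2, h3⟩ <;> refine ⟨?_, ?_, ?_⟩ <;> linarith

lemma one_half_le_volume_stdTriangle : ENNReal.ofReal (1 / 2) ≤ volume stdTriangle := by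
  have h1 : MeasurableSet stdTriangle := by
    refine IsOpen.measurableSet ?_
    exact (isOpen_lt continuous_const (continuous_apply 0)).inter
      ((isOpen_lt continuous_const (continuous_apply 1)).inter
        (isOpen_lt ((continuous_apply 0).add (continuous_apply 1)) continuous_const))
  let r : (Fin 2 → ℝ) → Fin 2 → ℝ := fun x => 1 - x
  have hr : volume (r ⁻¹' stdTriangle) = volume stdTriangle :=
    (Measure.measurePreserving_sub_left volume (1 : Fin 2 → ℝ)).measure_preimage
      h1.nullMeasurableSet
  have hd : volume {x : Fin 2 → ℝ | x 0 + x 1 = 1} = 0 := by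
    let s : AffineSubspace ℝ (Fin 2 → ℝ) :=
      { carrier := {x | x 0 + x 1 = 1}
        smul_vsub_vadd_mem' := fun c x y z hx hy hz => by
          simp only [Set.mem_ofPred_eq, vsub_eq_sub, vadd_eq_add, Pi.add_apply, Pi.smul_apply,
            Pi.sub_apply, smul_eq_mul] at *
          linear_combination c * hx - c * hy + hz }
    refine Measure.addHaar_affineSubspace volume s fun h => ?_
    have h0 : (0 : Fin 2 → ℝ) ∈ s := h ▸ AffineSubspace.mem_top ℝ _ _
    exact zero_ne_one ((add_zero (0 : ℝ)).symm.trans h0)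
  have hsub : (Set.univ.pi fun _ => Set.Ioo 0 1 : Set (Fin 2 → ℝ)) ⊆
      stdTriangle ∪ r ⁻¹' stdTriangle ∪ {x | x 0 + x 1 = 1} := by
    intro x hx
    have h0 := hx 0 trivial
    have h1 := hx 1 trivial
    rcases lt_trichotomy (x 0 + x 1) 1 with h | h | h
    · exact Or.inl (Or.inl ⟨h0.1, h1.1, h⟩)
    · exact Or.inr h
    · refine Or.inl (Or.inr ⟨?_, ?_, ?_⟩) <;> simp [r] <;> linarith [h0.2, h1.2]
  have h2 := (measure_mono (μ := volume) hsub).trans (measure_union_le _ _)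
  rw [hd, add_zero] at h2
  replace h2 := h2.trans (measure_union_le _ _)
  rw [hr, Real.volume_pi_Ioo, ← two_mul] at h2
  simp only [sub_zero, ENNReal.ofReal_one, Finset.prod_const_one] at h2
  rwa [one_div, ENNReal.ofReal_inv_of_pos two_pos, ENNReal.ofReal_ofNat,
    ENNReal.inv_le_iff_le_mul (by simp) (by simp)]

section
variable {n : ℕ} {Ω : Set (EuclideanSpace ℝ (Fin n))}

lemma setIntegral_sq_eq {u : EuclideanSpace ℝ (Fin n) → ℝ} (hu : tsupport u ⊆ Ω) :
    ∫ x in Ω, u x ^ 2 = ∫ x, u x ^ 2 :=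
  setIntegral_eq_integral_of_forall_compl_eq_zero fun x hx => by
    rw [image_eq_zero_of_notMem_tsupport fun h => hx (hu h), zero_pow two_ne_zero]

lemma tsupport_gradient_subset (u : EuclideanSpace ℝ (Fin n) → ℝ) :
    tsupport (gradient u) ⊆ tsupport u := by
  refine closure_minimal (fun x hx => ?_) (isClosed_tsupport u)
  by_contra h
  refine hx ?_
  have : fderiv ℝ u x = 0 := image_eq_zero_of_notMem_tsupport fun h' =>
    h (tsupport_fderiv_subset ℝ h')
  simp [gradient, this]

lemma setIntegral_norm_gradient_sq_eq {u : EuclideanSpace ℝ (Fin n) → ℝ} (hu : tsupport u ⊆ Ω) :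
    ∫ x in Ω, ‖gradient u x‖ ^ 2 = ∫ x, ‖gradient u x‖ ^ 2 :=
  setIntegral_eq_integral_of_forall_compl_eq_zero fun x hx => by
    rw [image_eq_zero_of_notMem_tsupport fun h => hx (hu (tsupport_gradient_subset u h)),
      norm_zero, zero_pow two_ne_zero]

lemma continuous_gradient {u : EuclideanSpace ℝ (Fin n) → ℝ} (hu : ContDiff ℝ (⊤ : ℕ∞) u) :
    Continuous (gradient u) :=
  (LinearIsometryEquiv.continuous _).comp (hu.continuous_fderiv (by simp))

lemma sq_norm_toLp_eq_integral {X F : Type*} [MeasurableSpace X] {μ : Measure X}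
    [NormedAddCommGroup F] [InnerProductSpace ℝ F] {f : X → F} (hf : MemLp f 2 μ) :
    ‖hf.toLp f‖ ^ 2 = ∫ x, ‖f x‖ ^ 2 ∂μ := by
  rw [← real_inner_self_eq_norm_sq, L2.inner_def]
  refine integral_congr_ae ?_
  filter_upwards [hf.coeFn_toLp] with x hx
  rw [hx, real_inner_self_eq_norm_sq]

lemma exists_norm_le_mul_norm_of_injective {E X Y : Type*} [AddCommGroup E] [Module ℝ E]
    [FiniteDimensional ℝ E] [NormedAddCommGroup X] [NormedSpace ℝ X] [NormedAddCommGroup Y]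
    [NormedSpace ℝ Y] (f : E →ₗ[ℝ] X) (hf : Function.Injective f) (g : E →ₗ[ℝ] Y) :
    ∃ c : ℝ, ∀ u, ‖g u‖ ≤ c * ‖f u‖ := by
  let e := LinearEquiv.ofInjective f hf
  let L : LinearMap.range f →L[ℝ] Y := (g ∘ₗ e.symm.toLinearMap).toContinuousLinearMap
  refine ⟨‖L‖, fun u => ?_⟩
  have h := L.le_opNorm (e u)
  have h1 : L (e u) = g u := congrArg g (e.symm_apply_apply u)
  rw [h1] at h
  exact h

theorem bddAbove_rayleigh (E : Submodule ℝ (EuclideanSpace ℝ (Fin n) → ℝ)) [FiniteDimensional ℝ E]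
    (hE : ∀ u ∈ E, ContDiff ℝ (⊤ : ℕ∞) u ∧ HasCompactSupport u ∧ tsupport u ⊆ Ω) :
    BddAbove { q : ℝ | ∃ u ∈ E, u ≠ (0 : EuclideanSpace ℝ (Fin n) → ℝ) ∧
        q = (∫ x in Ω, ‖gradient u x‖ ^ 2) / (∫ x in Ω, (u x) ^ 2) } := by
  have hf : ∀ u : E, MemLp (u : EuclideanSpace ℝ (Fin n) → ℝ) 2 volume := fun u =>
    (hE u u.2).1.continuous.memLp_of_hasCompactSupport (hE u u.2).2.1
  have hg : ∀ u : E, MemLp (gradient (u : EuclideanSpace ℝ (Fin n) → ℝ)) 2 volume := fun u =>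
    (continuous_gradient (hE u u.2).1).memLp_of_hasCompactSupport
      ((hE u u.2).2.1.of_isClosed_subset (isClosed_tsupport _) (tsupport_gradient_subset _))
  have hd : ∀ u : E, Differentiable ℝ (u : EuclideanSpace ℝ (Fin n) → ℝ) := fun u =>
    (hE u u.2).1.differentiable (by simp)
  let f : E →ₗ[ℝ] Lp ℝ 2 (volume : Measure (EuclideanSpace ℝ (Fin n))) :=
    { toFun := fun u => (hf u).toLp _
      map_add' := fun u v => rfl
      map_smul' := fun c u => rfl }
  let g : E →ₗ[ℝ] Lp (EuclideanSpace ℝ (Fin n)) 2 (volume : Measure (EuclideanSpace ℝ (Fin n))) :=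
    { toFun := fun u => (hg u).toLp _
      map_add' := fun u v => by
        rw [← MemLp.toLp_add]
        congr 1
        ext1 x
        simp [gradient, fderiv_add (hd u x) (hd v x)]
      map_smul' := fun c u => by
        rw [RingHom.id_apply, ← MemLp.toLp_const_smul]
        congr 1
        ext1 x
        simp [gradient, fderiv_const_smul (hd u x)] }
  have hinj : Function.Injective f := by
    intro u v h
    have h1 := (MemLp.toLp_eq_toLp_iff (hf u) (hf v)).1 h
    exact Subtype.ext
      (((hE u u.2).1.continuous.ae_eq_iff_eq volume (hE v v.2).1.continuous).1 h1)
  obtain ⟨c, hc⟩ := exists_norm_le_mul_norm_of_injective f hinj g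
  refine ⟨c ^ 2, ?_⟩
  rintro q ⟨u, hu, -, rfl⟩
  rw [setIntegral_sq_eq (hE u hu).2.2, setIntegral_norm_gradient_sq_eq (hE u hu).2.2]
  refine div_le_of_le_mul₀ (integral_nonneg fun x => sq_nonneg _) (sq_nonneg c) ?_
  have h := pow_le_pow_left₀ (norm_nonneg _) (hc ⟨u, hu⟩) 2
  rw [mul_pow] at h
  have h1 : ‖f ⟨u, hu⟩‖ ^ 2 = ∫ x, u x ^ 2 := by
    exact (sq_norm_toLp_eq_integral (hf ⟨u, hu⟩)).trans (by simp only [norm_eq_abs, sq_abs])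
  rw [← h1, ← sq_norm_toLp_eq_integral (hg ⟨u, hu⟩)]
  exact h

lemma integral_sq_pos {u : EuclideanSpace ℝ (Fin n) → ℝ} (hu : Continuous u)
    (hc : HasCompactSupport u) (h0 : u ≠ 0) : 0 < ∫ x, u x ^ 2 := by
  obtain ⟨x, hx⟩ := Function.ne_iff.1 h0
  exact (hu.pow 2).integral_pos_of_hasCompactSupport_nonneg_nonzero
    (by simpa only [sq] using hc.mul_right (f' := u)) (fun x => sq_nonneg _) (pow_ne_zero 2 hx)

theorem exists_testSubmodule_finrank_eq [NeZero n] (hΩ : IsOpen Ω) (hne : Ω.Nonempty) (k : ℕ) :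
    ∃ E : Submodule ℝ (EuclideanSpace ℝ (Fin n) → ℝ), Module.finrank ℝ E = k ∧
      ∀ u ∈ E, ContDiff ℝ (⊤ : ℕ∞) u ∧ HasCompactSupport u ∧ tsupport u ⊆ Ω := by
  have hinf : Ω.Infinite := by
    obtain ⟨x, hx⟩ := hne
    exact infinite_of_mem_nhds x (hΩ.mem_nhds hx)
  obtain ⟨s, hs, hcard⟩ := hinf.exists_subset_card_eq k
  have hf : ∀ x : s, ∃ f : EuclideanSpace ℝ (Fin n) → ℝ, tsupport f ⊆ Ω \ (s.erase x : Finset _) ∧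
      HasCompactSupport f ∧ ContDiff ℝ (⊤ : ℕ∞) f ∧ f x = 1 := by
    intro x
    have hmem : Ω \ (s.erase x : Finset _) ∈ nhds (x : EuclideanSpace ℝ (Fin n)) :=
      (hΩ.sdiff (s.erase x).finite_toSet.isClosed).mem_nhds ⟨hs x.2, by simp⟩
    obtain ⟨f, h1, h2, h3, -, h4⟩ := exists_contDiff_tsupport_subset (n := (⊤ : ℕ∞)) hmem
    exact ⟨f, h1, h2, h3, h4⟩
  choose f hfs hfc hfd hf1 using hf
  have hli : LinearIndependent ℝ f := by
    rw [Fintype.linearIndependent_iff]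
    intro g hg x
    have h := congrFun hg x
    rw [Finset.sum_apply, Finset.sum_eq_single x] at h
    · simpa [hf1] using h
    · intro y _ hyx
      have : f y x = 0 := by
        refine image_eq_zero_of_notMem_tsupport fun h' => (hfs y h').2 ?_
        exact Finset.mem_coe.2 (Finset.mem_erase.2 ⟨fun h => hyx (Subtype.ext h.symm), x.2⟩)
      simp [this]
    · simp
  refine ⟨Submodule.span ℝ (Set.range f), ?_, fun u hu => ?_⟩
  · rw [finrank_span_eq_card hli, Fintype.card_coe, hcard]
  · induction hu using Submodule.span_induction with
    | mem u hu =>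
      obtain ⟨x, rfl⟩ := hu
      exact ⟨hfd x, hfc x, (hfs x).trans Set.sdiff_subset⟩
    | zero => exact ⟨contDiff_const, HasCompactSupport.zero, by simp [tsupport]⟩
    | add u v _ _ hu hv =>
      exact ⟨hu.1.add hv.1, hu.2.1.add hv.2.1,
        (tsupport_add u v).trans (Set.union_subset hu.2.2 hv.2.2)⟩
    | smul c u _ hu =>
      exact ⟨contDiff_const.smul hu.1, hu.2.1.smul_left (f := fun _ => c),
        (tsupport_smul_subset_right (fun _ => c) u).trans hu.2.2⟩

end

lemma integral_comp_matrixEquiv_add (Q : Matrix (Fin 2) (Fin 2) ℝ) (hQ : Q.det ≠ 0)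
    (A : EuclideanSpace ℝ (Fin 2)) (f : EuclideanSpace ℝ (Fin 2) → ℝ) :
    ∫ x, f (matrixEquiv Q hQ x + A) = |Q.det|⁻¹ * ∫ y, f y := by
  rw [← integral_add_right_eq_self (μ := volume) f A, ← smul_eq_mul,
    ← ENNReal.toReal_ofReal (inv_nonneg.2 (abs_nonneg Q.det)), ← integral_smul_measure,
    ← map_matrixEquiv_volume Q hQ]
  exact ((matrixEquiv Q hQ).toHomeomorph.measurableEmbedding.integral_map
    fun y => f (y + A)).symm

lemma matrixEquiv_inv_transpose_row (Q : Matrix (Fin 2) (Fin 2) ℝ) (hQ : Q.det ≠ 0) (i : Fin 2) :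
    matrixEquiv Q hQ ((Q⁻¹).transpose i) = EuclideanSpace.single i 1 := by
  have h : Q.mulVec ((Q⁻¹).transpose i) = Pi.single i 1 := by
    ext j
    have h1 : (Q * Q⁻¹) j i = (1 : Matrix (Fin 2) (Fin 2) ℝ) j i := by
      rw [Matrix.mul_nonsing_inv Q (isUnit_iff_ne_zero.2 hQ)]
    rw [Matrix.one_apply] at h1
    rw [Pi.single_apply]
    exact h1
  rw [matrixEquiv_apply, h]
  rfl

lemma norm_gradient_sq {n : ℕ} (u : EuclideanSpace ℝ (Fin n) → ℝ) (y : EuclideanSpace ℝ (Fin n)) :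
    ‖gradient u y‖ ^ 2 = ∑ i, fderiv ℝ u y (EuclideanSpace.single i 1) ^ 2 := by
  rw [EuclideanSpace.norm_sq_eq]
  refine Finset.sum_congr rfl fun i _ => ?_
  rw [norm_eq_abs, sq_abs]
  congr 1
  have h : inner ℝ (gradient u y) (EuclideanSpace.single i 1) =
      fderiv ℝ u y (EuclideanSpace.single i 1) := by
    simp [gradient]
  rw [← h, EuclideanSpace.inner_single_right]
  simp

lemma sum_integral_fderiv_comp_matrixEquiv_add_sq (Q : Matrix (Fin 2) (Fin 2) ℝ) (hQ : Q.det ≠ 0)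
    (A : EuclideanSpace ℝ (Fin 2)) {u : EuclideanSpace ℝ (Fin 2) → ℝ}
    (hu : ContDiff ℝ (⊤ : ℕ∞) u) (hc : HasCompactSupport u) :
    ∑ i, ∫ x, fderiv ℝ (fun x => u (matrixEquiv Q hQ x + A)) x ((Q⁻¹).transpose i) ^ 2 =
      |Q.det|⁻¹ * ∫ y, ‖gradient u y‖ ^ 2 := by
  have h : ∀ i x, fderiv ℝ (fun x => u (matrixEquiv Q hQ x + A)) x ((Q⁻¹).transpose i) =
      fderiv ℝ u (matrixEquiv Q hQ x + A) (EuclideanSpace.single i 1) := by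
    intro i x
    have h1 : HasFDerivAt (fun x => u (matrixEquiv Q hQ x + A)) _ x :=
      ((hu.differentiable (by simp) (matrixEquiv Q hQ x + A)).hasFDerivAt).comp x
        ((matrixEquiv Q hQ).hasFDerivAt.add_const A)
    rw [h1.fderiv, ← matrixEquiv_inv_transpose_row Q hQ i]
    rfl
  simp only [h, norm_gradient_sq]
  rw [integral_finsetSum, Finset.mul_sum]
  · exact Finset.sum_congr rfl fun i _ => integral_comp_matrixEquiv_add Q hQ A
      fun y => fderiv ℝ u y (EuclideanSpace.single i 1) ^ 2
  · exact fun i _ => integrable_sq_of_hasCompactSupport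
      ((hu.continuous_fderiv (by simp)).clm_apply continuous_const) (hc.fderiv_apply ℝ _)

/-- Pólya's bound for the dimension of a test space of a triangle on which the Rayleigh quotient is
less than `M`. -/
theorem finrank_le_of_energy_lt {A B C : EuclideanSpace ℝ (Fin 2)}
    (h : ¬ Collinear ℝ ({A, B, C} : Set (EuclideanSpace ℝ (Fin 2))))
    (E : Submodule ℝ (EuclideanSpace ℝ (Fin 2) → ℝ)) [FiniteDimensional ℝ E]
    (hE : ∀ u ∈ E, ContDiff ℝ (⊤ : ℕ∞) u ∧ HasCompactSupport u ∧
      tsupport u ⊆ interior (convexHull ℝ {A, B, C})) {M : ℝ} (hM : 0 < M)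
    (hlt : ∀ u ∈ E, u ≠ 0 → ∫ x, ‖gradient u x‖ ^ 2 < M * ∫ x, u x ^ 2) :
    4 * π * Module.finrank ℝ E ≤ M * volume.real (interior (convexHull ℝ {A, B, C})) := by
  set T : Set (EuclideanSpace ℝ (Fin 2)) := interior (convexHull ℝ {A, B, C}) with hT
  have hpre := preimage_interior_convexHull h
  rw [← hT] at hpre
  have hQ := det_edges_ne_zero h
  set Q : Matrix (Fin 2) (Fin 2) ℝ := !![B 0 - A 0, C 0 - A 0; B 1 - A 1, C 1 - A 1]
  have hd : 0 < |Q.det| := abs_pos.2 hQ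
  have hvol : |Q.det| ≤ 2 * volume.real T := by
    have h1 : volume stdTriangle = ENNReal.ofReal |Q.det|⁻¹ * volume T := by
      have h2 : stdTriangle = matrixEquiv Q hQ ⁻¹' ((fun y => y + A) ⁻¹' T) := hpre.symm
      rw [h2, volume_preimage_matrixEquiv Q hQ _ (isOpen_interior.preimage
        (continuous_add_const A)).measurableSet, measure_preimage_add_right]
    have hfin : volume T ≠ ⊤ := by
      refine ((measure_mono interior_subset).trans_lt (IsCompact.measure_lt_top ?_)).ne
      exact (Set.toFinite {A, B, C}).isCompact_convexHull ℝ
    have h3 := one_half_le_volume_stdTriangle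
    rw [h1, ← ENNReal.ofReal_toReal hfin, ← ENNReal.ofReal_mul (by positivity),
      ENNReal.ofReal_le_ofReal_iff (by positivity), inv_mul_eq_div, le_div_iff₀ hd] at h3
    change _ ≤ 2 * (volume T).toReal
    linarith
  have hP : (Q⁻¹).transpose.det ≠ 0 := by
    rw [Matrix.det_transpose, Matrix.det_nonsing_inv, Ring.inverse_eq_inv']
    exact inv_ne_zero hQ
  have hPd : |(Q⁻¹).transpose.det| = |Q.det|⁻¹ := by
    rw [Matrix.det_transpose, Matrix.det_nonsing_inv, Ring.inverse_eq_inv', abs_inv]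
  let V : E →ₗ[ℝ] (Fin 2 → ℝ) → ℝ :=
    (LinearMap.funLeft ℝ ℝ fun x => matrixEquiv Q hQ x + A) ∘ₗ E.subtype
  have hcont : Continuous fun x => matrixEquiv Q hQ x + A :=
    (matrixEquiv Q hQ).continuous.add continuous_const
  have key := le_of_sq_mul_le_card_freqEllipse (Q⁻¹).transpose hP hM (2 * Module.finrank ℝ E)
    fun n hn S hS => mul_finrank_le_card_of_energy_lt V
      (fun u => ((hE u u.2).1.of_le (by simp)).comp
        ((matrixEquiv Q hQ).contDiff.add contDiff_const))
      (fun u => ?_) (Q⁻¹).transpose M (fun u hu => ?_) hn S hS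
  · rw [hPd, le_div_iff₀ (by positivity)] at key
    push_cast at key
    have h4 : 4 * π * (2 * Module.finrank ℝ E : ℝ) ≤ M * |Q.det| := by
      calc _ = 2 * (Module.finrank ℝ E : ℝ) * (4 * π * |Q.det|⁻¹) * |Q.det| := by
            field_simp
        _ ≤ _ := mul_le_mul_of_nonneg_right key hd.le
    linarith [mul_le_mul_of_nonneg_left hvol hM.le]
  · rw [← hpre]
    exact (tsupport_comp_subset_preimage _ hcont).trans (Set.preimage_mono (hE u u.2).2.2)
  · have h5 := sum_integral_fderiv_comp_matrixEquiv_add_sq Q hQ A (hE u u.2).1 (hE u u.2).2.1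
    have h6 := integral_comp_matrixEquiv_add Q hQ A fun y =>
      (u : EuclideanSpace ℝ (Fin 2) → ℝ) y ^ 2
    change ∑ i, ∫ x, fderiv ℝ (fun x => (u : EuclideanSpace ℝ (Fin 2) → ℝ)
        (matrixEquiv Q hQ x + A)) x ((Q⁻¹).transpose i) ^ 2 <
      M * ∫ x, (u : EuclideanSpace ℝ (Fin 2) → ℝ) (matrixEquiv Q hQ x + A) ^ 2
    rw [h5, h6, mul_left_comm]
    exact mul_lt_mul_of_pos_left (hlt u u.2 fun h => hu (Subtype.ext h)) (inv_pos.2 hd)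

/-- Pólya's conjecture for Dirichlet eigenvalues on triangles:
for every open triangular region `T ⊆ ℝ²` and `k ≥ 1`, `λ_k(T) ≥ 4πk/|T|`. -/
theorem polya_dirichlet_triangle
    (A B C : EuclideanSpace ℝ (Fin 2))
    (hnc : ¬ Collinear ℝ ({A, B, C} : Set (EuclideanSpace ℝ (Fin 2))))
    (k : ℕ) (hk : 1 ≤ k) :
    dirichletEig (interior (convexHull ℝ ({A, B, C} : Set (EuclideanSpace ℝ (Fin 2))))) k ≥
      4 * π * k /
        (volume (interior (convexHull ℝ ({A, B, C} : Set (EuclideanSpace ℝ (Fin 2)))))).toReal := by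
  have hne : (interior (convexHull ℝ ({A, B, C} : Set (EuclideanSpace ℝ (Fin 2))))).Nonempty := by
    have h : ((fun x => matrixEquiv _ (det_edges_ne_zero hnc) x + A) ⁻¹'
        interior (convexHull ℝ {A, B, C})).Nonempty := by
      rw [preimage_interior_convexHull hnc]
      exact ⟨fun _ => 1 / 3, by norm_num [stdTriangle]⟩
    obtain ⟨x, hx⟩ := h
    exact ⟨_, hx⟩
  refine le_csInf ?_ ?_
  · obtain ⟨E, h1, h2⟩ := exists_testSubmodule_finrank_eq isOpen_interior hne k
    exact ⟨_, E, h1, h2, rfl⟩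
  rintro r ⟨E, hfin, hE, rfl⟩
  have : FiniteDimensional ℝ E := FiniteDimensional.of_finrank_pos (by omega)
  have hbdd := bddAbove_rayleigh E hE
  refine le_of_forall_gt_imp_ge_of_dense fun M hM => ?_
  have hpos : ∀ u ∈ E, u ≠ 0 → 0 < ∫ x, u x ^ 2 := fun u hu h0 =>
    integral_sq_pos (hE u hu).1.continuous (hE u hu).2.1 h0
  have hlt : ∀ u ∈ E, u ≠ 0 → ∫ x, ‖gradient u x‖ ^ 2 < M * ∫ x, u x ^ 2 := by
    intro u hu h0
    rw [← div_lt_iff₀ (hpos u hu h0), ← setIntegral_norm_gradient_sq_eq (hE u hu).2.2,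
      ← setIntegral_sq_eq (hE u hu).2.2]
    exact (le_csSup hbdd ⟨u, hu, h0, rfl⟩).trans_lt hM
  have hM0 : 0 < M := by
    obtain ⟨u, hu, h0⟩ := E.ne_bot_iff.1 fun h => by
      rw [h, finrank_bot] at hfin
      omega
    exact pos_of_mul_pos_left
      ((integral_nonneg fun x => sq_nonneg _).trans_lt (hlt u hu h0)) (hpos u hu h0).le
  have h := finrank_le_of_energy_lt hnc E hE hM0 hlt
  rw [hfin] at h
  exact div_le_of_le_mul₀ ENNReal.toReal_nonneg hM0.le h
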